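/- arXiv:1005.5662 — 2 statements merged into one kernel-verified Lean document; each statement's English description precedes it below -/
import Mathlib

section
/- For every partial function F from Bool* (finite Boolean strings) to Bool there exists a constant c ∈ ℕ such that for every k ∈ ℕ, the restriction F_k of F to Bool^k is computed by a loop-free PGLB_bt instruction sequence of length at most c·2^k using 0 auxiliary registers. Consequently, the class of partial functions all of whose restrictions are computable by loop-free instruction sequences of length at most c·2^k for some constant c equals the class of all partial functions from Bool* to Bool. -/
/-- A focus (register name): an input register `in:i` or an auxiliary register `aux:i`. -/
inductive Focus
  | inp (i : ℕ)
  | aux (i : ℕ)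
  deriving DecidableEq

/-- A method of a Boolean register service. -/
inductive Method
  | setT
  | setF
  | get
  deriving DecidableEq

/-- A PGLB_bt primitive instruction. -/
inductive Instr
  | basic (f : Focus) (m : Method)   -- f.m
  | pos (f : Focus) (m : Method)     -- +f.m
  | neg (f : Focus) (m : Method)     -- -f.m
  | fjmp (l : ℕ)                     -- #l
  | bjmp (l : ℕ)                     -- \#l
  | termT                            -- !t
  | termF                            -- !f
  deriving DecidableEq

/-- A state assigns to every register a value in {t, f, d}; `none` represents `d`. -/
abbrev St := Focus → Option Bool

/-- The reply produced when processing method `m` on a register holding `x`. -/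
def procReply (m : Method) (x : Option Bool) : Option Bool :=
  match x, m with
  | none, _ => none
  | some b, .get => some b
  | some _, .setT => some true
  | some _, .setF => some true

/-- The new register value after processing method `m` on a register holding `x`. -/
def procEff (m : Method) (x : Option Bool) : Option Bool :=
  match x, m with
  | none, _ => none
  | some b, .get => some b
  | some _, .setT => some true
  | some _, .setF => some false

/-- Update a state by processing method `m` on the register named `f`. -/
def updSt (s : St) (f : Focus) (m : Method) : St :=
  fun g => if g = f then procEff m (s f) else s g

/-- An execution configuration: running at a (1-based) position in a state,
terminated with a reply (recording the final state), or deadlocked. -/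
inductive Config
  | running (i : ℕ) (s : St)
  | terminated (r : Bool) (s : St)
  | deadlock

/-- One execution step of the instruction sequence `I`. -/
def step (I : List Instr) : Config → Config
  | .terminated r s => .terminated r s
  | .deadlock => .deadlock
  | .running i s =>
    if i = 0 then .deadlock
    else
      match I[i - 1]? with
      | none => .deadlock
      | some u =>
        match u with
        | .basic f m =>
          match procReply m (s f) with
          | none => .deadlock
          | some _ => .running (i + 1) (updSt s f m)
        | .pos f m =>
          match procReply m (s f) with
          | none => .deadlock
          | some true => .running (i + 1) (updSt s f m)
          | some false => .running (i + 2) (updSt s f m)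
        | .neg f m =>
          match procReply m (s f) with
          | none => .deadlock
          | some true => .running (i + 2) (updSt s f m)
          | some false => .running (i + 1) (updSt s f m)
        | .fjmp l => .running (i + l) s
        | .bjmp l => if l < i then .running (i - l) s else .deadlock
        | .termT => .terminated true s
        | .termF => .terminated false s

/-- The configuration after `n` execution steps of `I`, starting at position 1 in state `s`. -/
def run (I : List Instr) (s : St) (n : ℕ) : Config :=
  (step I)^[n] (.running 1 s)

/-- Execution of `I` from state `s` terminates with reply `r`. -/
def TermWith (I : List Instr) (s : St) (r : Bool) : Prop :=
  ∃ n s', run I s n = .terminated r s'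

/-- An instruction sequence is loop-free if it contains no backward jump. -/
def LoopFree (I : List Instr) : Prop := ∀ l, Instr.bjmp l ∉ I

/-- An instruction refers to an auxiliary register. -/
def UsesAux : Instr → Prop
  | .basic (.aux _) _ => True
  | .pos (.aux _) _ => True
  | .neg (.aux _) _ => True
  | _ => False

/-- The initial state for computing a `k`-ary function using `l` auxiliary registers:
`in:i` holds `b_i` for `1 ≤ i ≤ k`, `aux:j` holds `t` for `1 ≤ j ≤ l`,
all other registers hold `d`. -/
def initSt (k l : ℕ) (b : Fin k → Bool) : St
  | .inp i => if h : 1 ≤ i ∧ i ≤ k then some (b ⟨i - 1, by omega⟩) else none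
  | .aux j => if 1 ≤ j ∧ j ≤ l then some true else none

/-- `I` computes the partial function `F : Bool^k ⇀ Bool` using `l` auxiliary registers. -/
def Computes (I : List Instr) (k l : ℕ) (F : (Fin k → Bool) → Option Bool) : Prop :=
  ∀ b : Fin k → Bool,
    (∀ r : Bool, F b = some r → TermWith I (initSt k l b) r) ∧
    (F b = none → ∀ r : Bool, ¬ TermWith I (initSt k l b) r)

/-- The restriction of a partial function on `Bool*` to `Bool^k`. -/
def Restrict (F : List Bool → Option Bool) (k : ℕ) : (Fin k → Bool) → Option Bool :=
  fun b => F (List.ofFn b)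

/-- The loop-free decision tree that reads `in:(j+1)`, …, `in:(j+m)` and replies with the value of
`F` at the string read; undefined values are realised by the self-jump `#0`. -/
def decisionTree : (F : List Bool → Option Bool) → (j m : ℕ) → List Instr
  | F, _, 0 =>
    match F [] with
    | some true => [.termT]
    | some false => [.termF]
    | none => [.fjmp 0]
  | F, j, m + 1 =>
    let A := decisionTree (fun l => F (true :: l)) (j + 1) m
    let B := decisionTree (fun l => F (false :: l)) (j + 1) m
    [.pos (.inp (j + 1)) .get, .fjmp 2, .fjmp (A.length + 1)] ++ (A ++ B)

theorem length_decisionTree (F : List Bool → Option Bool) (j m : ℕ) :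
    (decisionTree F j m).length + 3 = 4 * 2 ^ m := by
  induction m generalizing F j with
  | zero =>
    rcases h : F [] with _ | _ | _ <;> simp [decisionTree, h]
  | succ m ih =>
    have hA := ih (fun l => F (true :: l)) (j + 1)
    have hB := ih (fun l => F (false :: l)) (j + 1)
    simp only [decisionTree, List.length_append, List.length_cons, List.length_nil, pow_succ]
    omega

theorem loopFree_decisionTree (F : List Bool → Option Bool) (j m : ℕ) :
    LoopFree (decisionTree F j m) := by
  intro l
  induction m generalizing F j with
  | zero =>
    rcases h : F [] with _ | _ | _ <;> simp [decisionTree, h]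
  | succ m ih => simp [decisionTree, ih]

theorem updSt_get (s : St) (f : Focus) : updSt s f .get = s := by
  funext g
  by_cases h : g = f
  · subst h
    rcases h : s g with _ | b <;> simp [updSt, procEff, h]
  · simp [updSt, h]

/-- Execution of `I` from `c` settles in a fixed point of `step I`, which is a termination with
reply `r` exactly when `o = some r`. -/
def SettlesTo (I : List Instr) (o : Option Bool) (c : Config) : Prop :=
  ∃ n, step I ((step I)^[n] c) = (step I)^[n] c ∧
    ∀ r, o = some r ↔ ∃ s, (step I)^[n] c = .terminated r s

theorem SettlesTo.of_step {I : List Instr} {o : Option Bool} {c c' : Config}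
    (hc : step I c = c') (h : SettlesTo I o c') : SettlesTo I o c := by
  obtain ⟨n, h⟩ := h
  refine ⟨n + 1, ?_⟩
  rwa [Function.iterate_succ_apply, hc]

theorem SettlesTo.of_fixed {I : List Instr} {o : Option Bool} {c : Config}
    (hc : step I c = c) (h : ∀ r, o = some r ↔ ∃ s, c = .terminated r s) : SettlesTo I o c :=
  ⟨0, hc, h⟩

theorem SettlesTo.termWith_iff {I : List Instr} {o : Option Bool} {s : St}
    (h : SettlesTo I o (.running 1 s)) (r : Bool) : TermWith I s r ↔ o = some r := by
  obtain ⟨n, hfix, hr⟩ := h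
  rw [hr]
  constructor
  · rintro ⟨n', s', hn'⟩
    refine ⟨s', ?_⟩
    have h₁ : (step I)^[n' + n] (.running 1 s) = (step I)^[n] (.running 1 s) := by
      rw [Function.iterate_add_apply, Function.iterate_fixed hfix]
    have h₂ : (step I)^[n + n'] (.running 1 s) = .terminated r s' := by
      rw [Function.iterate_add_apply]
      exact (congrArg _ hn').trans (Function.iterate_fixed rfl n)
    rw [← h₁, add_comm, h₂]
  · rintro ⟨s', h'⟩
    exact ⟨n, s', h'⟩

theorem settlesTo_decisionTree (b : List Bool) (F : List Bool → Option Bool) (j : ℕ) (s : St)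
    (hs : ∀ i (hi : i < b.length), s (.inp (j + 1 + i)) = some b[i]) (pre post : List Instr) :
    SettlesTo (pre ++ decisionTree F j b.length ++ post) (F b) (.running (pre.length + 1) s) := by
  induction b generalizing F j pre post with
  | nil =>
    rcases h : F [] with _ | _ | _
    · exact .of_fixed (by simp [decisionTree, step, h]) (by simp)
    · exact .of_step (c' := .terminated false s) (by simp [decisionTree, step, h])
        (.of_fixed rfl (by simp))
    · exact .of_step (c' := .terminated true s) (by simp [decisionTree, step, h])
        (.of_fixed rfl (by simp))
  | cons x b ih =>
    have hx : s (.inp (j + 1)) = some x := hs 0 (by simp)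
    have hs' : ∀ i (hi : i < b.length), s (.inp (j + 1 + 1 + i)) = some b[i] := by
      intro i hi
      have := hs (i + 1) (by simpa using hi)
      rwa [show j + 1 + (i + 1) = j + 1 + 1 + i by omega] at this
    set A := decisionTree (fun l => F (true :: l)) (j + 1) b.length with hA
    set B := decisionTree (fun l => F (false :: l)) (j + 1) b.length with hB
    have hI : decisionTree F j (x :: b).length =
        [.pos (.inp (j + 1)) .get, .fjmp 2, .fjmp (A.length + 1)] ++ (A ++ B) := rfl
    rw [hI]
    cases x with
    | true =>
      refine .of_step (c' := .running (pre.length + 2) s)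
        (by simp [step, hx, procReply, updSt_get]) ?_
      refine .of_step (c' := .running (pre.length + 4) s) (by simp [step]) ?_
      have := ih (fun l => F (true :: l)) (j + 1) hs'
        (pre ++ [.pos (.inp (j + 1)) .get, .fjmp 2, .fjmp (A.length + 1)]) (B ++ post)
      simp only [← hA] at this
      simpa using this
    | false =>
      refine .of_step (c' := .running (pre.length + 3) s)
        (by simp [step, hx, procReply, updSt_get]) ?_
      refine .of_step (c' := .running (pre.length + (A.length + 4)) s)
        (by simp [step]; omega) ?_
      have := ih (fun l => F (false :: l)) (j + 1) hs'
        (pre ++ [.pos (.inp (j + 1)) .get, .fjmp 2, .fjmp (A.length + 1)] ++ A) post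
      simpa [← hB, add_assoc] using this

theorem computes_decisionTree (F : List Bool → Option Bool) (k : ℕ) :
    Computes (decisionTree F 0 k) k 0 (Restrict F k) := by
  intro b
  have h := settlesTo_decisionTree (List.ofFn b) F 0 (initSt k 0 b) (by
    intro i hi
    have hi' : i < k := by simpa using hi
    have : 1 ≤ 0 + 1 + i ∧ 0 + 1 + i ≤ k := by omega
    simp [initSt]
    omega) [] []
  simp only [List.length_ofFn, List.nil_append, List.append_nil, List.length_nil, zero_add] at h
  refine ⟨fun r hr => (h.termWith_iff r).2 hr, fun hn r ht => ?_⟩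
  exact Option.some_ne_none r (((h.termWith_iff r).1 ht).symm.trans hn)

theorem exists_loopFree_computes (F : List Bool → Option Bool) : ∃ c : ℕ, ∀ k : ℕ,
    ∃ I : List Instr, I ≠ [] ∧ LoopFree I ∧ I.length ≤ c * 2 ^ k ∧
      Computes I k 0 (Restrict F k) := by
  refine ⟨4, fun k => ⟨decisionTree F 0 k, ?_, loopFree_decisionTree F 0 k, ?_,
    computes_decisionTree F k⟩⟩
  · intro h
    have := length_decisionTree F 0 k
    rw [h, List.length_nil] at this
    omega
  · have := length_decisionTree F 0 k
    omega

/-- Every partial function `F : Bool* ⇀ Bool` has a constant `c` such that each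
restriction `F_k` is computed by a loop-free instruction sequence of length at most
`c·2^k` using 0 auxiliary registers; consequently the class `IS^lf_E` of partial
functions all of whose restrictions are computable by loop-free instruction sequences
of length at most `c·2^k` (for some constant `c`) is the class of all partial functions
from `Bool*` to `Bool`. -/
theorem statement1 :
    (∀ F : List Bool → Option Bool, ∃ c : ℕ, ∀ k : ℕ,
      ∃ I : List Instr, I ≠ [] ∧ LoopFree I ∧ I.length ≤ c * 2 ^ k ∧
        Computes I k 0 (Restrict F k)) ∧
    {F : List Bool → Option Bool | ∃ c : ℕ, ∀ k : ℕ,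
      ∃ I : List Instr, I ≠ [] ∧ LoopFree I ∧ I.length ≤ c * 2 ^ k ∧
        ∃ l : ℕ, Computes I k l (Restrict F k)} = Set.univ := by
  refine ⟨exists_loopFree_computes, Set.eq_univ_of_forall fun F => ?_⟩
  obtain ⟨c, hc⟩ := exists_loopFree_computes F
  refine ⟨c, fun k => ?_⟩
  obtain ⟨I, hne, hlf, hlen, hI⟩ := hc k
  exact ⟨I, hne, hlf, hlen, 0, hI⟩
end

section
/- Let F assign to every k ≥ 1 a total function F_k : Bool^k → Bool. Then the following are equivalent: (i) there is a polynomial function h : ℕ → ℕ such that for every k ≥ 1 some loop-free instruction sequence of length at most h(k) computes F_k (viewed as an everywhere-defined partial function) using some number of auxiliary registers; (ii) there is a polynomial function p : ℕ → ℕ such that for every k ≥ 1 some Boolean circuit over k inputs of size at most p(k) computes F_k. (This is the identity IS^lf_P ∩ [Bool* → Bool] = P/poly, using the characterization of P/poly as the class of families of total Boolean functions with polynomial-size Boolean circuits.) -/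
/-- An argument of a gate: an input `x_j` or an earlier gate `g_m` (both 1-based). -/
inductive GateArg
  | input (j : ℕ)
  | gate (m : ℕ)

/-- A gate of a Boolean circuit. -/
inductive Gate
  | not (p : GateArg)
  | and (p q : GateArg)
  | or (p q : GateArg)

/-- The value of a gate argument, given the input vector `b` and the list `vals` of
values of the earlier gates. -/
def argVal (k : ℕ) (b : Fin k → Bool) (vals : List Bool) : GateArg → Bool
  | .input j => if h : 1 ≤ j ∧ j ≤ k then b ⟨j - 1, by omega⟩ else false
  | .gate m => vals.getD (m - 1) false

/-- The value of a gate, given the input vector and the values of the earlier gates. -/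
def gateVal (k : ℕ) (b : Fin k → Bool) (vals : List Bool) : Gate → Bool
  | .not p => ! argVal k b vals p
  | .and p q => argVal k b vals p && argVal k b vals q
  | .or p q => argVal k b vals p || argVal k b vals q

/-- The list of values of all gates of the circuit `C` on input `b`. -/
def evalCircuit (k : ℕ) (b : Fin k → Bool) (C : List Gate) : List Bool :=
  C.foldl (fun vals g => vals ++ [gateVal k b vals g]) []

/-- The output of the circuit `C` on input `b`: the value of its last gate. -/
def circuitVal (k : ℕ) (b : Fin k → Bool) (C : List Gate) : Bool :=
  (evalCircuit k b C).getLast?.getD false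

/-- Well-formedness of a gate argument occurring in the gate with (1-based) index `idx`
of a circuit over `k` inputs: it refers to an input `x_j` with `1 ≤ j ≤ k` or to an
earlier gate. -/
def ArgWF (k idx : ℕ) : GateArg → Prop
  | .input j => 1 ≤ j ∧ j ≤ k
  | .gate m => 1 ≤ m ∧ m < idx

/-- Well-formedness of the gate with (1-based) index `idx`. -/
def GateWF (k idx : ℕ) : Gate → Prop
  | .not p => ArgWF k idx p
  | .and p q => ArgWF k idx p ∧ ArgWF k idx q
  | .or p q => ArgWF k idx p ∧ ArgWF k idx q

/-- A well-formed Boolean circuit over `k` inputs: a nonempty list of well-formed gates. -/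
def CircuitWF (k : ℕ) (C : List Gate) : Prop :=
  C ≠ [] ∧ ∀ (idx : ℕ) (g : Gate), C[idx]? = some g → GateWF k (idx + 1) g

/-- A Boolean function of `k` arguments. -/
abbrev BoolFun (k : ℕ) := (Fin k → Bool) → Bool

/-- Every gate of `C` is well formed (`C` may be empty). -/
def GatesWF (k : ℕ) (C : List Gate) : Prop :=
  ∀ (idx : ℕ) (g : Gate), C[idx]? = some g → GateWF k (idx + 1) g

theorem GatesWF.append_singleton {k : ℕ} {C : List Gate} {g : Gate} (hC : GatesWF k C)
    (hg : GateWF k (C.length + 1) g) : GatesWF k (C ++ [g]) := by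
  intro idx g' h
  rcases lt_trichotomy idx C.length with h1 | h1 | h1
  · rw [List.getElem?_append_left h1] at h
    exact hC idx g' h
  · subst h1
    simp at h
    exact h ▸ hg
  · rw [List.getElem?_eq_none (by simp; omega)] at h
    simp at h

theorem GatesWF.of_append_singleton {k : ℕ} {C : List Gate} {g : Gate}
    (h : GatesWF k (C ++ [g])) : GatesWF k C ∧ GateWF k (C.length + 1) g := by
  refine ⟨fun idx g' h' => h idx g' ?_, h C.length g (by simp)⟩
  rw [List.getElem?_append_left (List.getElem?_eq_some_iff.1 h').1]
  exact h'

theorem evalCircuit_append_singleton (k : ℕ) (b : Fin k → Bool) (C : List Gate) (g : Gate) :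
    evalCircuit k b (C ++ [g])
      = evalCircuit k b C ++ [gateVal k b (evalCircuit k b C) g] := by
  simp [evalCircuit]

@[simp]
theorem length_evalCircuit (k : ℕ) (b : Fin k → Bool) (C : List Gate) :
    (evalCircuit k b C).length = C.length := by
  induction C using List.reverseRecOn with
  | nil => simp [evalCircuit]
  | append_singleton C g ih => simp [evalCircuit_append_singleton, ih]

theorem argVal_append (k : ℕ) (b : Fin k → Bool) (v w : List Bool) {a : GateArg}
    (ha : ArgWF k (v.length + 1) a) : argVal k b (v ++ w) a = argVal k b v a := by
  cases a with
  | input j => rfl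
  | gate m =>
    obtain ⟨h1, h2⟩ := ha
    simp only [argVal]
    exact List.getD_append _ _ _ _ (by omega)

theorem circuitVal_append_singleton (k : ℕ) (b : Fin k → Bool) (C : List Gate) (g : Gate) :
    circuitVal k b (C ++ [g]) = gateVal k b (evalCircuit k b C) g := by
  simp [circuitVal, evalCircuit_append_singleton]

/-- The function `φ` is the value of an input or of a gate of `C`. -/
def Represents (k : ℕ) (C : List Gate) (φ : BoolFun k) : Prop :=
  ∃ a, ArgWF k (C.length + 1) a ∧ ∀ b, argVal k b (evalCircuit k b C) a = φ b

theorem Represents.append_singleton {k : ℕ} {C : List Gate} {φ : BoolFun k}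
    (h : Represents k C φ) (g : Gate) : Represents k (C ++ [g]) φ := by
  obtain ⟨a, ha, hv⟩ := h
  refine ⟨a, ?_, fun b => ?_⟩
  · cases a with
    | input j => exact ha
    | gate m => exact ⟨ha.1, by have := ha.2; simp; omega⟩
  · rw [evalCircuit_append_singleton, argVal_append k b _ _ (by simpa using ha), hv]

theorem represents_last (k : ℕ) (C : List Gate) (g : Gate) :
    Represents k (C ++ [g]) (fun b => gateVal k b (evalCircuit k b C) g) := by
  refine ⟨.gate (C.length + 1), ⟨by omega, by simp⟩, fun b => ?_⟩
  simp [argVal, evalCircuit_append_singleton, List.getD_eq_getElem?_getD]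

/-- All functions in `S` are represented in a single circuit with at most `n` gates. -/
def Avail (k n : ℕ) (S : Set (BoolFun k)) : Prop :=
  ∃ C, GatesWF k C ∧ C.length ≤ n ∧ ∀ φ ∈ S, Represents k C φ

theorem Avail.exists_gate {k n : ℕ} {S : Set (BoolFun k)} {φ : BoolFun k} (h : Avail k n S)
    (hg : ∀ C, (∀ ψ ∈ S, Represents k C ψ) → ∃ g, GateWF k (C.length + 1) g ∧
      ∀ b, gateVal k b (evalCircuit k b C) g = φ b) :
    ∃ S', S ⊆ S' ∧ Avail k (n + 1) S' ∧ φ ∈ S' := by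
  obtain ⟨C, hC, hn, hS⟩ := h
  obtain ⟨g, hg, hv⟩ := hg C hS
  refine ⟨insert φ S, Set.subset_insert _ _, ?_, Set.mem_insert _ _⟩
  refine ⟨C ++ [g], hC.append_singleton hg, by simpa using hn, ?_⟩
  rintro ψ (rfl | hψ)
  · have := represents_last k C g
    simpa only [hv] using this
  · exact (hS ψ hψ).append_singleton g

theorem Avail.exists_and {k n : ℕ} {S : Set (BoolFun k)} {φ ψ : BoolFun k} (h : Avail k n S)
    (hφ : φ ∈ S) (hψ : ψ ∈ S) :
    ∃ S', S ⊆ S' ∧ Avail k (n + 1) S' ∧ (fun b => φ b && ψ b) ∈ S' := by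
  refine h.exists_gate fun C hS => ?_
  obtain ⟨p, hp, hpv⟩ := hS φ hφ
  obtain ⟨q, hq, hqv⟩ := hS ψ hψ
  exact ⟨.and p q, ⟨hp, hq⟩, fun b => by simp [gateVal, hpv, hqv]⟩

theorem Avail.exists_or {k n : ℕ} {S : Set (BoolFun k)} {φ ψ : BoolFun k} (h : Avail k n S)
    (hφ : φ ∈ S) (hψ : ψ ∈ S) :
    ∃ S', S ⊆ S' ∧ Avail k (n + 1) S' ∧ (fun b => φ b || ψ b) ∈ S' := by
  refine h.exists_gate fun C hS => ?_
  obtain ⟨p, hp, hpv⟩ := hS φ hφ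
  obtain ⟨q, hq, hqv⟩ := hS ψ hψ
  exact ⟨.or p q, ⟨hp, hq⟩, fun b => by simp [gateVal, hpv, hqv]⟩

theorem Avail.exists_not {k n : ℕ} {S : Set (BoolFun k)} {φ : BoolFun k} (h : Avail k n S)
    (hφ : φ ∈ S) :
    ∃ S', S ⊆ S' ∧ Avail k (n + 1) S' ∧ (fun b => !φ b) ∈ S' := by
  refine h.exists_gate fun C hS => ?_
  obtain ⟨p, hp, hpv⟩ := hS φ hφ
  exact ⟨.not p, hp, fun b => by simp [gateVal, hpv]⟩

theorem Avail.mono {k n m : ℕ} {S : Set (BoolFun k)} (h : Avail k n S) (hnm : n ≤ m) :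
    Avail k m S := by
  obtain ⟨C, hC, hn, hS⟩ := h
  exact ⟨C, hC, hn.trans hnm, hS⟩

theorem Avail.exists_circuit {k n : ℕ} {S : Set (BoolFun k)} {φ : BoolFun k} (h : Avail k n S)
    (hφ : φ ∈ S) : ∃ C, CircuitWF k C ∧ C.length ≤ n + 1 ∧ ∀ b, circuitVal k b C = φ b := by
  obtain ⟨C, hC, hn, hS⟩ := h
  obtain ⟨p, hp, hpv⟩ := hS φ hφ
  refine ⟨C ++ [.and p p], ⟨by simp, ?_⟩, by simpa using hn, fun b => ?_⟩
  · exact hC.append_singleton (g := .and p p) ⟨hp, hp⟩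
  · simp [circuitVal_append_singleton, gateVal, hpv]

theorem avail_inputs_const {k : ℕ} (hk : 1 ≤ k) :
    ∃ S, Avail k 3 S ∧ (∀ x : Bool, (fun _ => x) ∈ S) ∧ ∀ j : Fin k, (fun b => b j) ∈ S := by
  have h0 : Avail k 0 {φ : BoolFun k | ∃ j : Fin k, φ = fun b => b j} := by
    refine ⟨[], by simp [GatesWF], by simp, ?_⟩
    rintro φ ⟨j, rfl⟩
    exact ⟨.input (j + 1), ⟨by omega, by omega⟩, fun b => by simp [argVal]⟩
  obtain ⟨S1, m1, h1, e1⟩ := h0.exists_not (φ := fun b => b ⟨0, hk⟩) ⟨_, rfl⟩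
  obtain ⟨S2, m2, h2, e2⟩ := h1.exists_and (m1 ⟨⟨0, hk⟩, rfl⟩) e1
  obtain ⟨S3, m3, h3, e3⟩ := h2.exists_not e2
  refine ⟨S3, h3, fun x => ?_, fun j => m3 (m2 (m1 ⟨j, rfl⟩))⟩
  cases x
  · simpa using m3 e2
  · simpa using e3

/-- Execution of `I` from the configuration `c` terminates with reply `r`. -/
def Halts (I : List Instr) (c : Config) (r : Bool) : Prop :=
  ∃ n s', (step I)^[n] c = .terminated r s'

theorem Halts.step {I : List Instr} {c : Config} {r : Bool} (h : Halts I c r) :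
    Halts I (step I c) r := by
  obtain ⟨n, s', h⟩ := h
  refine ⟨n, s', ?_⟩
  rw [← Function.iterate_succ_apply, Function.iterate_succ_apply', h]
  rfl

theorem Halts.of_fixed {I : List Instr} {c : Config} {r : Bool} (h : Halts I c r)
    (hc : _root_.step I c = c) : ∃ s', c = .terminated r s' := by
  obtain ⟨n, s', h⟩ := h
  exact ⟨s', by rw [← h, Function.iterate_fixed hc]⟩

theorem not_halts_deadlock {I : List Instr} {r : Bool} : ¬ Halts I .deadlock r := fun h => by
  obtain ⟨s', h⟩ := h.of_fixed rfl
  cases h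

namespace Config

/-- The configuration is running at position `j`. -/
def isAt (j : ℕ) : Config → Bool
  | running i _ => i == j
  | _ => false

/-- The value of register `f`, with the value `t` in place of `d`. -/
def regVal (f : Focus) : Config → Bool
  | running _ s => (s f).getD true
  | terminated _ s => (s f).getD true
  | deadlock => true

/-- The configuration has terminated with reply `t`. -/
def accepts : Config → Bool
  | terminated r _ => r
  | _ => false

/-- Perform one step of `I` if the configuration is running at position `i`. -/
def advance (I : List Instr) (i : ℕ) (c : Config) : Config :=
  if c.isAt i then step I c else c

end Config

/-- The configurations `c b` lie on the executions of `I` with replies `F b`, are at position at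
least `i` while running, and are described by functions in `S`. -/
structure Tracks (k : ℕ) (I : List Instr) (F : BoolFun k) (i : ℕ) (c : (Fin k → Bool) → Config)
    (S : Set (BoolFun k)) : Prop where
  halts : ∀ b, Halts I (c b) (F b)
  le : ∀ b p s, c b = .running p s → i ≤ p
  const : ∀ x : Bool, (fun _ => x) ∈ S
  isAt : ∀ j, (fun b => (c b).isAt j) ∈ S
  regVal : ∀ f, (fun b => (c b).regVal f) ∈ S
  accepts : (fun b => (c b).accepts) ∈ S

/-- Sufficient conditions for tracking the execution past position `i`. -/
theorem Tracks.advance {k : ℕ} {I : List Instr} {F : BoolFun k} {i : ℕ}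
    {c : (Fin k → Bool) → Config} {S S' : Set (BoolFun k)} (h : Tracks k I F i c S)
    (hSS : S ⊆ S')
    (hlt : ∀ s r p s', Halts I (.running i s) r → step I (.running i s) = .running p s' → i < p)
    (isAt : ∀ j, i < j → (fun b => ((c b).advance I i).isAt j) ∈ S')
    (regVal : ∀ f, (fun b => ((c b).advance I i).regVal f) ∈ S')
    (accepts : (fun b => ((c b).advance I i).accepts) ∈ S') :
    Tracks k I F (i + 1) (fun b => (c b).advance I i) S' := by
  have hle : ∀ b p s, (c b).advance I i = .running p s → i + 1 ≤ p := by
    intro b p s hb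
    have hH := h.halts b
    have hl := h.le b
    unfold Config.advance at hb
    cases hc : c b with
    | terminated r s => simp [hc, Config.isAt] at hb
    | deadlock => simp [hc, Config.isAt] at hb
    | running q s1 =>
      have := hl q s1 hc
      rw [hc] at hb hH
      by_cases hq : q = i
      · subst hq
        simp only [Config.isAt, beq_self_eq_true, if_true] at hb
        exact hlt s1 _ p s hH hb
      · simp [Config.isAt, hq] at hb
        omega
  refine ⟨fun b => ?_, hle, fun x => hSS (h.const x), fun j => ?_, regVal, accepts⟩
  · unfold Config.advance
    split
    · exact (h.halts b).step
    · exact h.halts b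
  · by_cases hj : i < j
    · exact isAt j hj
    · convert hSS (h.const false) using 1
      funext b
      cases hc : (c b).advance I i with
      | terminated r s => rfl
      | deadlock => rfl
      | running q s =>
        have := hle b q s hc
        simp [Config.isAt]
        omega

/-- The reply of method `m` on register `f`, with `t` in place of `d`. -/
def Config.reply (f : Focus) (m : Method) (c : Config) : Bool :=
  (procReply m (some (c.regVal f))).getD true

section Register

variable {I : List Instr} {i : ℕ} {f : Focus} {m : Method} {off : Bool → ℕ}

theorem exists_step_register
    (hstep : ∀ s, step I (.running i s) = match procReply m (s f) with
      | none => .deadlock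
      | some r => .running (i + off r) (updSt s f m))
    {s : St} {r : Bool} (h : Halts I (.running i s) r) :
    ∃ x, s f = some x ∧ step I (.running i s)
      = .running (i + off ((Config.running i s).reply f m)) (updSt s f m) := by
  cases hx : s f with
  | none =>
    have := h.step
    rw [hstep, hx] at this
    cases m <;> exact absurd this not_halts_deadlock
  | some x =>
    refine ⟨x, rfl, ?_⟩
    rw [hstep, hx]
    cases m <;> simp [Config.reply, Config.regVal, procReply, hx]

theorem isAt_advance_register
    (hstep : ∀ s, step I (.running i s) = match procReply m (s f) with
      | none => .deadlock
      | some r => .running (i + off r) (updSt s f m))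
    {c : Config} {r : Bool} (h : Halts I c r) {j : ℕ} (hj : i < j) :
    (c.advance I i).isAt j = (c.isAt j || (c.isAt i && i + off (c.reply f m) == j)) := by
  cases c with
  | terminated r s => rfl
  | deadlock => rfl
  | running q s =>
    by_cases hq : q = i
    · subst hq
      obtain ⟨x, -, hs⟩ := exists_step_register hstep h
      have hne : (q == j) = false := by simpa using hj.ne
      simp [Config.advance, Config.isAt, hs, hne]
    · simp [Config.advance, Config.isAt, hq]

theorem regVal_advance_register
    (hstep : ∀ s, step I (.running i s) = match procReply m (s f) with
      | none => .deadlock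
      | some r => .running (i + off r) (updSt s f m))
    {c : Config} {r : Bool} (h : Halts I c r) (g : Focus) :
    (c.advance I i).regVal g = if g = f then
      (match m with
        | .get => c.regVal f
        | .setT => c.isAt i || c.regVal f
        | .setF => !c.isAt i && c.regVal f) else c.regVal g := by
  by_cases hc : c.isAt i = true
  · cases c with
    | terminated r s => simp [Config.isAt] at hc
    | deadlock => simp [Config.isAt] at hc
    | running q s =>
      obtain rfl : q = i := by simpa [Config.isAt] using hc
      obtain ⟨x, hx, hs⟩ := exists_step_register hstep h
      by_cases hg : g = f
      · subst hg
        cases m <;> simp [Config.advance, Config.isAt, hs, Config.regVal, updSt, procEff, hx]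
      · simp [Config.advance, Config.isAt, hs, Config.regVal, updSt, hg]
  · simp only [Bool.not_eq_true] at hc
    by_cases hg : g = f
    · subst hg
      cases m <;> simp [Config.advance, hc]
    · simp [Config.advance, hc, hg]

theorem accepts_advance_register
    (hstep : ∀ s, step I (.running i s) = match procReply m (s f) with
      | none => .deadlock
      | some r => .running (i + off r) (updSt s f m))
    (c : Config) : (c.advance I i).accepts = c.accepts := by
  cases c with
  | terminated r s => rfl
  | deadlock => rfl
  | running q s =>
    by_cases hq : q = i
    · subst hq
      simp only [Config.advance, Config.isAt, beq_self_eq_true, if_true, hstep]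
      split <;> rfl
    · simp [Config.advance, Config.isAt, hq]

theorem Tracks.exists_register {k n : ℕ} {F : BoolFun k}
    {c : (Fin k → Bool) → Config} {S : Set (BoolFun k)}
    (h : Tracks k I F i c S) (hS : Avail k n S)
    (hoff : ∀ r, off r = 1 ∨ off r = 2)
    (hstep : ∀ s, step I (.running i s) = match procReply m (s f) with
      | none => .deadlock
      | some r => .running (i + off r) (updSt s f m)) :
    ∃ S', Avail k (n + 8) S' ∧ Tracks k I F (i + 1) (fun b => (c b).advance I i) S' := by
  have hρ : (fun b => (c b).reply f m) ∈ S := by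
    cases m
    · exact h.const true
    · exact h.const true
    · exact h.regVal f
  obtain ⟨S1, m1, h1, hn⟩ := hS.exists_not hρ
  have hbranch : ∀ g : Bool → Bool, (fun b => g ((c b).reply f m)) ∈ S1 := by
    intro g
    obtain ⟨u, v, rfl⟩ : ∃ u v, g = fun x => if x then u else v :=
      ⟨g true, g false, by funext x; cases x <;> rfl⟩
    cases u <;> cases v
    · simpa using m1 (h.const false)
    · simpa using hn
    · simpa using m1 hρ
    · simpa using m1 (h.const true)
  obtain ⟨S2, m2, h2, e2⟩ := h1.exists_and (m1 (h.isAt i))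
    (hbranch fun r => i + off r == i + 1)
  obtain ⟨S3, m3, h3, e3⟩ := h2.exists_or (m2 (m1 (h.isAt (i + 1)))) e2
  have m3' := m1.trans (m2.trans m3)
  obtain ⟨S4, m4, h4, e4⟩ := h3.exists_and (m3' (h.isAt i))
    (m3 (m2 (hbranch fun r => i + off r == i + 2)))
  obtain ⟨S5, m5, h5, e5⟩ := h4.exists_or (m4 (m3' (h.isAt (i + 2)))) e4
  have m5' := m3'.trans (m4.trans m5)
  obtain ⟨S6, m6, h6, e6⟩ := h5.exists_or (m5' (h.isAt i)) (m5' (h.regVal f))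
  have m6' := m5'.trans m6
  obtain ⟨S7, m7, h7, e7⟩ := h6.exists_not (m6' (h.isAt i))
  obtain ⟨S8, m8, h8, e8⟩ := h7.exists_and e7 (m7 (m6' (h.regVal f)))
  have mS := m6'.trans (m7.trans m8)
  refine ⟨S8, h8, h.advance mS ?_ (fun j hj => ?_) (fun g => ?_) ?_⟩
  · intro s r p s' hH hs
    obtain ⟨x, -, hs'⟩ := exists_step_register hstep hH
    have := hoff ((Config.running i s).reply f m)
    rw [hs'] at hs
    simp only [Config.running.injEq] at hs
    omega
  · simp only [fun b => isAt_advance_register hstep (h.halts b) hj]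
    by_cases hj1 : j = i + 1
    · subst hj1
      exact m8 (m7 (m6 (m5 (m4 e3))))
    by_cases hj2 : j = i + 2
    · subst hj2
      exact m8 (m7 (m6 e5))
    convert mS (h.isAt j) using 2 with b
    have := hoff ((c b).reply f m)
    have hne : (i + off ((c b).reply f m) == j) = false := by
      rw [beq_eq_false_iff_ne]
      omega
    simp [hne]
  · simp only [fun b => regVal_advance_register hstep (h.halts b) g]
    by_cases hg : g = f
    · simp only [hg, if_true]
      cases m
      · exact m8 (m7 e6)
      · exact e8
      · exact mS (h.regVal f)
    · simpa only [hg, if_false] using mS (h.regVal g)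
  · simpa only [accepts_advance_register hstep] using mS h.accepts

end Register

/-- The effect of executing instruction `u` at position `i` in state `s`. -/
def exec (u : Instr) (i : ℕ) (s : St) : Config :=
  match u with
  | .basic f m =>
    match procReply m (s f) with
    | none => .deadlock
    | some _ => .running (i + 1) (updSt s f m)
  | .pos f m =>
    match procReply m (s f) with
    | none => .deadlock
    | some true => .running (i + 1) (updSt s f m)
    | some false => .running (i + 2) (updSt s f m)
  | .neg f m =>
    match procReply m (s f) with
    | none => .deadlock
    | some true => .running (i + 2) (updSt s f m)
    | some false => .running (i + 1) (updSt s f m)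
  | .fjmp l => .running (i + l) s
  | .bjmp l => if l < i then .running (i - l) s else .deadlock
  | .termT => .terminated true s
  | .termF => .terminated false s

theorem step_running {I : List Instr} {i : ℕ} {u : Instr} (hi : i ≠ 0) (hu : I[i - 1]? = some u)
    (s : St) : step I (.running i s) = exec u i s := by
  simp only [step, hi, if_false, hu]
  rfl

theorem Tracks.exists_fjmp {k n : ℕ} {I : List Instr} {F : BoolFun k} {i l : ℕ}
    {c : (Fin k → Bool) → Config} {S : Set (BoolFun k)} (h : Tracks k I F i c S)
    (hS : Avail k n S) (hstep : ∀ s, step I (.running i s) = .running (i + l) s) :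
    ∃ S', Avail k (n + 8) S' ∧ Tracks k I F (i + 1) (fun b => (c b).advance I i) S' := by
  obtain ⟨S1, m1, h1, e1⟩ := hS.exists_or (h.isAt (i + l)) (h.isAt i)
  have hadv : ∀ c : Config, (∀ g, (c.advance I i).regVal g = c.regVal g) ∧
      (c.advance I i).accepts = c.accepts ∧ ∀ j, i < j →
        (c.advance I i).isAt j = (c.isAt j || (c.isAt i && i + l == j)) := by
    intro c
    cases c with
    | terminated r s => simp [Config.advance, Config.isAt]
    | deadlock => simp [Config.advance, Config.isAt]
    | running q s =>
      by_cases hq : q = i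
      · subst hq
        simp only [Config.advance, Config.isAt, beq_self_eq_true, if_true, hstep]
        refine ⟨fun g => rfl, rfl, fun j hj => ?_⟩
        simp [hj.ne]
      · simp [Config.advance, Config.isAt, hq]
  refine ⟨S1, h1.mono (by omega), h.advance m1 ?_ (fun j hj => ?_) (fun g => ?_) ?_⟩
  · intro s r p s' hH hs
    rcases Nat.eq_zero_or_pos l with rfl | hl
    · obtain ⟨_, h'⟩ := hH.of_fixed (hstep s)
      cases h'
    · rw [hstep] at hs
      simp only [Config.running.injEq] at hs
      omega
  · simp only [fun b => (hadv (c b)).2.2 j hj]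
    by_cases hl : j = i + l
    · simpa [hl] using e1
    · have : (i + l == j) = false := by
        rw [beq_eq_false_iff_ne]
        omega
      simpa [this] using m1 (h.isAt j)
  · simpa only [fun b => (hadv (c b)).1 g] using m1 (h.regVal g)
  · simpa only [fun b => (hadv (c b)).2.1] using m1 h.accepts

theorem Tracks.exists_term {k n : ℕ} {I : List Instr} {F : BoolFun k} {i : ℕ} {x : Bool}
    {c : (Fin k → Bool) → Config} {S : Set (BoolFun k)} (h : Tracks k I F i c S)
    (hS : Avail k n S) (hstep : ∀ s, step I (.running i s) = .terminated x s) :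
    ∃ S', Avail k (n + 8) S' ∧ Tracks k I F (i + 1) (fun b => (c b).advance I i) S' := by
  obtain ⟨S1, m1, h1, e1⟩ := hS.exists_or h.accepts (h.isAt i)
  have hadv : ∀ c : Config, (∀ g, (c.advance I i).regVal g = c.regVal g) ∧
      (c.advance I i).accepts = (c.accepts || (c.isAt i && x)) ∧ ∀ j, i < j →
        (c.advance I i).isAt j = c.isAt j := by
    intro c
    cases c with
    | terminated r s => simp [Config.advance, Config.isAt]
    | deadlock => simp [Config.advance, Config.isAt]
    | running q s =>
      by_cases hq : q = i
      · subst hq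
        simp only [Config.advance, Config.isAt, beq_self_eq_true, if_true, hstep]
        refine ⟨fun g => rfl, by simp [Config.accepts], fun j hj => ?_⟩
        simp [hj.ne]
      · simp [Config.advance, Config.isAt, hq]
  refine ⟨S1, h1.mono (by omega), h.advance m1 ?_ (fun j hj => ?_) (fun g => ?_) ?_⟩
  · intro s r p s' hH hs
    rw [hstep] at hs
    cases hs
  · simpa only [fun b => (hadv (c b)).2.2 j hj] using m1 (h.isAt j)
  · simpa only [fun b => (hadv (c b)).1 g] using m1 (h.regVal g)
  · simp only [fun b => (hadv (c b)).2.1]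
    cases x
    · simpa using m1 h.accepts
    · simpa using e1

theorem Tracks.exists_advance {k n : ℕ} {I : List Instr} {F : BoolFun k} {i : ℕ} {u : Instr}
    {c : (Fin k → Bool) → Config} {S : Set (BoolFun k)} (h : Tracks k I F i c S)
    (hS : Avail k n S) (hi : i ≠ 0) (hu : I[i - 1]? = some u) (hI : LoopFree I) :
    ∃ S', Avail k (n + 8) S' ∧ Tracks k I F (i + 1) (fun b => (c b).advance I i) S' := by
  have hstep := step_running hi hu
  cases u with
  | basic f m => exact h.exists_register (off := fun _ => 1) hS (by simp) hstep
  | pos f m =>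
    refine h.exists_register (f := f) (m := m) (off := fun r => if r then 1 else 2) hS
      (by simp) fun s => ?_
    rw [hstep]
    simp only [exec]
    rcases procReply m (s f) with _ | _ | _ <;> rfl
  | neg f m =>
    refine h.exists_register (f := f) (m := m) (off := fun r => if r then 2 else 1) hS
      (by simp) fun s => ?_
    rw [hstep]
    simp only [exec]
    rcases procReply m (s f) with _ | _ | _ <;> rfl
  | fjmp l => exact h.exists_fjmp hS hstep
  | bjmp l => exact absurd (List.mem_of_getElem? hu) (hI l)
  | termT => exact h.exists_term hS hstep
  | termF => exact h.exists_term hS hstep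

theorem exists_tracks_init {k l : ℕ} {I : List Instr} {F : BoolFun k} (hk : 1 ≤ k)
    (hF : Computes I k l fun b => some (F b)) :
    ∃ S, Avail k 3 S ∧ Tracks k I F 1 (fun b => .running 1 (initSt k l b)) S := by
  obtain ⟨S, hS, hconst, hin⟩ := avail_inputs_const hk
  refine ⟨S, hS, fun b => (hF b).1 _ rfl, ?_, hconst, fun j => hconst _, fun f => ?_, hconst _⟩
  · intro b p s h
    simp only [Config.running.injEq] at h
    omega
  · cases f with
    | inp i =>
      by_cases hi : 1 ≤ i ∧ i ≤ k
      · simpa [Config.regVal, initSt, hi] using hin ⟨i - 1, by omega⟩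
      · simpa [Config.regVal, initSt, hi] using hconst true
    | aux i =>
      by_cases hi : 1 ≤ i ∧ i ≤ l <;> simpa [Config.regVal, initSt, hi] using hconst true

/-- A loop-free instruction sequence computing a total function is simulated by a circuit of
linear size. -/
theorem Computes.exists_circuit {k l : ℕ} {I : List Instr} {F : BoolFun k} (hk : 1 ≤ k)
    (hI : LoopFree I) (hF : Computes I k l fun b => some (F b)) :
    ∃ C, CircuitWF k C ∧ C.length ≤ 8 * I.length + 4 ∧ ∀ b, circuitVal k b C = F b := by
  have key : ∀ i ≤ I.length, ∃ c S, Avail k (8 * i + 3) S ∧ Tracks k I F (i + 1) c S := by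
    intro i
    induction i with
    | zero =>
      intro _
      obtain ⟨S, h1, h2⟩ := exists_tracks_init hk hF
      exact ⟨_, S, h1, h2⟩
    | succ i ih =>
      intro hi
      obtain ⟨c, S, h1, h2⟩ := ih (by omega)
      obtain ⟨S', h1', h2'⟩ := h2.exists_advance h1 (by omega)
        (List.getElem?_eq_getElem (by omega)) hI
      exact ⟨_, S', h1'.mono (by omega), h2'⟩
  obtain ⟨c, S, hS, h⟩ := key _ le_rfl
  obtain ⟨C, hC, hlen, hv⟩ := hS.exists_circuit h.accepts
  refine ⟨C, hC, hlen, fun b => ?_⟩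
  rw [hv]
  have hH := h.halts b
  cases hc : c b with
  | terminated r s =>
    rw [hc] at hH
    obtain ⟨s', h'⟩ := hH.of_fixed rfl
    cases h'
    rfl
  | deadlock => exact absurd (hc ▸ hH) not_halts_deadlock
  | running p s =>
    have hp := h.le b p s hc
    have hs := (hc ▸ hH).step
    have : step I (.running p s) = .deadlock := by
      have hn : I[p - 1]? = none := List.getElem?_eq_none (by omega)
      simp [step, hn]
    exact absurd (this ▸ hs) not_halts_deadlock

/-- Execution of `I` leads from configuration `c₁` to configuration `c₂`. -/
def Reaches (I : List Instr) (c₁ c₂ : Config) : Prop :=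
  ∃ n, (step I)^[n] c₁ = c₂

theorem Reaches.trans {I : List Instr} {c₁ c₂ c₃ : Config} (h : Reaches I c₁ c₂)
    (h' : Reaches I c₂ c₃) : Reaches I c₁ c₃ := by
  obtain ⟨n, rfl⟩ := h
  obtain ⟨m, rfl⟩ := h'
  exact ⟨m + n, Function.iterate_add_apply _ _ _ _⟩

/-- The register holding the value of a gate argument. -/
def GateArg.focus : GateArg → Focus
  | .input j => .inp j
  | .gate m => .aux m

/-- Instructions storing the value of a gate in register `aux:t`, provided that it initially
holds `t`. -/
def Gate.code (t : ℕ) : Gate → List Instr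
  | .not p => [.pos p.focus .get, .basic (.aux t) .setF]
  | .and p q =>
    [.neg p.focus .get, .basic (.aux t) .setF, .neg q.focus .get, .basic (.aux t) .setF]
  | .or p q => [.pos p.focus .get, .fjmp 3, .neg q.focus .get, .basic (.aux t) .setF]

theorem loopFree_code (t : ℕ) (g : Gate) : LoopFree (g.code t) := by
  intro l
  cases g <;> simp [Gate.code]

theorem length_code_le (t : ℕ) (g : Gate) : (g.code t).length ≤ 4 := by
  cases g <;> simp [Gate.code]

theorem updSt_setF {s : St} {f : Focus} {x : Bool} (h : s f = some x) :
    updSt s f .setF = Function.update s f (some false) := by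
  funext g
  by_cases hg : g = f
  · subst hg
    simp [updSt, procEff, h]
  · simp [updSt, hg]

theorem step_append (J B P : List Instr) {t : ℕ} {u : Instr} (h : B[t]? = some u) (s : St) :
    step (J ++ (B ++ P)) (.running (J.length + (t + 1)) s) = exec u (J.length + (t + 1)) s := by
  refine step_running (by omega) ?_ s
  rw [List.getElem?_append_right (by omega), List.getElem?_append_left, ← h]
  · congr 1
    omega
  · have := (List.getElem?_eq_some_iff.1 h).1
    omega

theorem ArgWF.focus_ne {k t : ℕ} {p : GateArg} (h : ArgWF k t p) : p.focus ≠ .aux t := by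
  cases p with
  | input j => simp [GateArg.focus]
  | gate m =>
    have := h.2
    simp only [GateArg.focus, ne_eq, Focus.aux.injEq]
    omega

theorem reaches_code {k t : ℕ} {b : Fin k → Bool} {vals : List Bool} {s : St} {g : Gate}
    (J P : List Instr) (hg : GateWF k t g)
    (hs : ∀ a, ArgWF k t a → s a.focus = some (argVal k b vals a)) (ht : s (.aux t) = some true) :
    Reaches (J ++ (g.code t ++ P)) (.running (J.length + 1) s)
      (.running (J.length + (g.code t).length + 1)
        (Function.update s (.aux t) (some (gateVal k b vals g)))) := by
  have hself : Function.update s (.aux t) (some true) = s := by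
    rw [← ht, Function.update_eq_self]
  have hset := updSt_setF ht
  cases g with
  | not p =>
    have hp := hs p hg
    have e1 := step_append J (Gate.code t (.not p)) P (t := 0) rfl
    have e2 := step_append J (Gate.code t (.not p)) P (t := 1) rfl
    simp only [Nat.zero_add, Nat.reduceAdd] at e1 e2
    generalize J ++ (Gate.code t (.not p) ++ P) = I at e1 e2 ⊢
    cases hx : argVal k b vals p
    · refine ⟨1, ?_⟩
      simp [e1, exec, hp, hx, procReply, updSt_get, gateVal, hself, Gate.code]
    · refine ⟨2, ?_⟩
      simp [e1, e2, exec, hp, hx, ht, procReply, updSt_get, gateVal, hset, Gate.code,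
        Nat.add_assoc]
  | and p q =>
    have hp := hs p hg.1
    have hq := hs q hg.2
    have hqt := hg.2.focus_ne
    have e1 := step_append J (Gate.code t (.and p q)) P (t := 0) rfl
    have e2 := step_append J (Gate.code t (.and p q)) P (t := 1) rfl
    have e3 := step_append J (Gate.code t (.and p q)) P (t := 2) rfl
    have e4 := step_append J (Gate.code t (.and p q)) P (t := 3) rfl
    have hset' : updSt (Function.update s (.aux t) (some false)) (.aux t) .setF
        = Function.update s (.aux t) (some false) := by
      rw [updSt_setF (Function.update_self ..), Function.update_idem]
    simp only [Nat.zero_add, Nat.reduceAdd] at e1 e2 e3 e4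
    generalize J ++ (Gate.code t (.and p q) ++ P) = I at e1 e2 e3 e4 ⊢
    cases hx : argVal k b vals p <;> cases hy : argVal k b vals q
    · refine ⟨4, ?_⟩
      simp [e1, e2, e3, e4, exec, hp, hx, hq, hy, hqt, ht, procReply, updSt_get, gateVal, hset,
        hset', Gate.code, Nat.add_assoc]
    · refine ⟨3, ?_⟩
      simp [e1, e2, e3, exec, hp, hx, hq, hy, hqt, ht, procReply, updSt_get, gateVal, hset,
        Gate.code, Nat.add_assoc]
    · refine ⟨3, ?_⟩
      simp [e1, e3, e4, exec, hp, hx, hq, hy, ht, procReply, updSt_get, gateVal, hset,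
        Gate.code, Nat.add_assoc]
    · refine ⟨2, ?_⟩
      simp [e1, e3, exec, hp, hx, hq, hy, procReply, updSt_get, gateVal, hself,
        Gate.code, Nat.add_assoc]
  | or p q =>
    have hp := hs p hg.1
    have hq := hs q hg.2
    have e1 := step_append J (Gate.code t (.or p q)) P (t := 0) rfl
    have e2 := step_append J (Gate.code t (.or p q)) P (t := 1) rfl
    have e3 := step_append J (Gate.code t (.or p q)) P (t := 2) rfl
    have e4 := step_append J (Gate.code t (.or p q)) P (t := 3) rfl
    simp only [Nat.zero_add, Nat.reduceAdd] at e1 e2 e3 e4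
    generalize J ++ (Gate.code t (.or p q) ++ P) = I at e1 e2 e3 e4 ⊢
    cases hx : argVal k b vals p
    · cases hy : argVal k b vals q
      · refine ⟨3, ?_⟩
        simp [e1, e3, e4, exec, hp, hx, hq, hy, ht, procReply, updSt_get, gateVal, hset,
          Gate.code, Nat.add_assoc]
      · refine ⟨2, ?_⟩
        simp [e1, e3, exec, hp, hx, hq, hy, procReply, updSt_get, gateVal, hself,
          Gate.code, Nat.add_assoc]
    · refine ⟨2, ?_⟩
      simp [e1, e2, exec, hp, hx, procReply, updSt_get, gateVal, hself,
        Gate.code, Nat.add_assoc]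

theorem exists_code {k : ℕ} (C : List Gate) (hC : GatesWF k C) :
    ∃ J, LoopFree J ∧ J.length ≤ 4 * C.length ∧ ∀ (b : Fin k → Bool) (l : ℕ) (P : List Instr),
      C.length ≤ l → ∃ s,
        Reaches (J ++ P) (.running 1 (initSt k l b)) (.running (J.length + 1) s) ∧
        (∀ a, ArgWF k (C.length + 1) a →
          s a.focus = some (argVal k b (evalCircuit k b C) a)) ∧
        ∀ m, C.length < m → m ≤ l → s (.aux m) = some true := by
  induction C using List.reverseRecOn with
  | nil =>
    refine ⟨[], by simp [LoopFree], by simp, fun b l P _ => ⟨_, ⟨0, rfl⟩, ?_, ?_⟩⟩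
    · intro a ha
      cases a with
      | input j =>
        have ha : 1 ≤ j ∧ j ≤ k := ha
        simp [GateArg.focus, initSt, argVal, ha]
      | gate m =>
        have h1 := ha.1
        have h2 := ha.2
        simp only [List.length_nil] at h2
        omega
    · intro m h1 h2
      have h1 : 1 ≤ m := h1
      simp [initSt, h1, h2]
  | append_singleton C g ih =>
    obtain ⟨hC, hg⟩ := hC.of_append_singleton
    obtain ⟨J, hJ, hlen, hJs⟩ := ih hC
    refine ⟨J ++ g.code (C.length + 1), fun i => ?_, ?_, fun b l P hl => ?_⟩
    · simpa using ⟨hJ i, loopFree_code _ g i⟩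
    · have := length_code_le (C.length + 1) g
      simp only [List.length_append, List.length_singleton]
      omega
    · simp only [List.length_append, List.length_singleton] at hl ⊢
      obtain ⟨s, hr, harg, haux⟩ := hJs b l (g.code (C.length + 1) ++ P) (by omega)
      have hrun := hr.trans (reaches_code J P hg harg (haux _ (by omega) hl))
      rw [← List.append_assoc] at hrun
      refine ⟨_, hrun, ?_, ?_⟩
      · intro a ha
        rw [evalCircuit_append_singleton]
        by_cases hw : ArgWF k (C.length + 1) a
        · rw [Function.update_of_ne hw.focus_ne, harg a hw,
            argVal_append _ _ _ _ (by simpa using hw)]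
        · cases a with
          | input j => exact absurd ha hw
          | gate m =>
            obtain rfl : m = C.length + 1 := by
              have h1 := ha.1
              have h2 := ha.2
              simp only [ArgWF] at hw
              omega
            simp [GateArg.focus, argVal, List.getD_eq_getElem?_getD]
      · intro m h1 h2
        rw [Function.update_of_ne (by simp only [ne_eq, Focus.aux.injEq]; omega)]
        exact haux m (by omega) h2

/-- A circuit is simulated by a loop-free instruction sequence of linear length. -/
theorem CircuitWF.exists_computes {k : ℕ} {C : List Gate} {F : BoolFun k} (hC : CircuitWF k C)
    (hF : ∀ b, circuitVal k b C = F b) :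
    ∃ I, I ≠ [] ∧ LoopFree I ∧ I.length ≤ 4 * C.length + 3 ∧
      ∃ l, Computes I k l fun b => some (F b) := by
  obtain ⟨J, hJ, hlen, hJs⟩ := exists_code C hC.2
  refine ⟨J ++ ([.pos (.aux C.length) .get, .termT, .termF] ++ []), by simp, fun i => ?_, ?_,
    C.length, fun b => ⟨?_, by simp⟩⟩
  · simpa using hJ i
  · simp only [List.length_append, List.length_cons, List.length_nil]
    omega
  · rintro r ⟨⟩
    obtain ⟨s, hr, harg, -⟩ :=
      hJs b C.length ([.pos (.aux C.length) .get, .termT, .termF] ++ []) le_rfl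
    have hpos : 1 ≤ C.length := List.length_pos_iff.2 hC.1
    have hv : s (.aux C.length) = some (F b) := by
      have := harg (.gate C.length) ⟨hpos, by omega⟩
      rw [← hF b]
      simpa [GateArg.focus, argVal, circuitVal, List.getLast?_eq_getElem?,
        List.getD_eq_getElem?_getD] using this
    have e1 := step_append J [.pos (.aux C.length) .get, .termT, .termF] [] (t := 0) rfl
    have e2 := step_append J [.pos (.aux C.length) .get, .termT, .termF] [] (t := 1) rfl
    have e3 := step_append J [.pos (.aux C.length) .get, .termT, .termF] [] (t := 2) rfl
    simp only [Nat.zero_add, Nat.reduceAdd] at e1 e2 e3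
    obtain ⟨n, hn⟩ : Reaches _ _ (.terminated (F b) s) := hr.trans ⟨2, by
      cases hx : F b <;> rw [hx] at hv
      · simp only [Function.iterate_succ_apply, e1, exec, hv, procReply, updSt_get, e3,
          Nat.add_assoc, Nat.reduceAdd, Function.iterate_zero_apply]
      · simp only [Function.iterate_succ_apply, e1, exec, hv, procReply, updSt_get, e2,
          Nat.add_assoc, Nat.reduceAdd, Function.iterate_zero_apply]⟩
    exact ⟨n, s, hn⟩

/-- `IS^lf_P ∩ [Bool* → Bool] = P/poly`: a family of total Boolean functions
`F_k : Bool^k → Bool` is computable by loop-free instruction sequences of polynomial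
length (using some number of auxiliary registers) iff it has polynomial-size Boolean
circuits. -/
theorem statement5 (F : (k : ℕ) → (Fin k → Bool) → Bool) :
    (∃ p : Polynomial ℕ, ∀ k : ℕ, 1 ≤ k →
      ∃ I : List Instr, I ≠ [] ∧ LoopFree I ∧ I.length ≤ p.eval k ∧
        ∃ l : ℕ, Computes I k l (fun b => some (F k b))) ↔
    (∃ p : Polynomial ℕ, ∀ k : ℕ, 1 ≤ k →
      ∃ C : List Gate, CircuitWF k C ∧ C.length ≤ p.eval k ∧
        ∀ b : Fin k → Bool, circuitVal k b C = F k b) := by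
  constructor
  · rintro ⟨p, hp⟩
    refine ⟨8 * p + 4, fun k hk => ?_⟩
    obtain ⟨I, -, hI, hlen, l, hF⟩ := hp k hk
    obtain ⟨C, hC, hlenC, hv⟩ := hF.exists_circuit hk hI
    refine ⟨C, hC, ?_, hv⟩
    simp only [Polynomial.eval_add, Polynomial.eval_mul, Polynomial.eval_ofNat]
    omega
  · rintro ⟨p, hp⟩
    refine ⟨4 * p + 3, fun k hk => ?_⟩
    obtain ⟨C, hC, hlen, hv⟩ := hp k hk
    obtain ⟨I, hne, hI, hlenI, hF⟩ := hC.exists_computes hv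
    refine ⟨I, hne, hI, ?_, hF⟩
    simp only [Polynomial.eval_add, Polynomial.eval_mul, Polynomial.eval_ofNat]
    omega
end
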